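/- Let B ≥ 1, let Ω be a finite nonempty set of vectors x : Fin B → ℝ with M = |Ω|, and let α : Fin B → ℝ. Let μ be the product of B copies of the standard Gaussian measure N(0,1) on (Fin B → ℝ). For γ > 0 define J(γ) = log₂ M − (1/M) ∑_{x ∈ Ω} ∫ log₂( ∑_{x' ∈ Ω} exp( −γ ∑_b α(b)² (x(b) − x'(b))² + √(2γ) ∑_b g(b) α(b) (x(b) − x'(b)) ) ) dμ(g), and let c = (∑_b α(b)² V_b) / log 2, where V_b = (1/(2M²)) ∑_{x ∈ Ω} ∑_{x' ∈ Ω} (x(b) − x'(b))². Then J(γ) − γ·c = o(γ) as γ → 0 from the right, i.e., (fun γ => J(γ) − γ·c) is little-o of (fun γ => γ) along the filter of right neighbourhoods of 0. -/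

import Mathlib

open Finset MeasureTheory Asymptotics

lemma aux_exp_le (v : ℝ) : Real.exp v ≤ v + Real.exp (v ^ 2) := by
  have h0 := Real.add_one_le_exp (v ^ 2)
  rcases le_total |v| 1 with h | h
  · have := (abs_le.1 (Real.abs_exp_sub_one_sub_id_le h)).2
    linarith
  · rcases le_abs.1 h with h | h
    · have : Real.exp v ≤ Real.exp (v ^ 2) := Real.exp_le_exp.2 (by nlinarith)
      linarith
    · have : Real.exp v ≤ 1 := Real.exp_le_one_iff.2 (by linarith)
      nlinarith

lemma aux_log_bound {ι : Type*} (S : Finset ι) (hS : S.Nonempty) (v : ι → ℝ)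
    (hv : ∑ i ∈ S, v i = 0) :
    0 ≤ Real.log ((∑ i ∈ S, Real.exp (v i)) / S.card) ∧
    Real.log ((∑ i ∈ S, Real.exp (v i)) / S.card) ≤ ∑ i ∈ S, v i ^ 2 := by
  have hn : (0 : ℝ) < S.card := by exact_mod_cast hS.card_pos
  have h1 : (S.card : ℝ) ≤ ∑ i ∈ S, Real.exp (v i) := by
    calc (S.card : ℝ) = ∑ i ∈ S, (v i + 1) := by
          rw [Finset.sum_add_distrib, hv]; simp
      _ ≤ _ := Finset.sum_le_sum fun i _ => Real.add_one_le_exp _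
  refine ⟨Real.log_nonneg ((one_le_div hn).2 h1), ?_⟩
  rw [Real.log_le_iff_le_exp (div_pos (by linarith) hn), div_le_iff₀ hn]
  calc ∑ i ∈ S, Real.exp (v i) ≤ ∑ i ∈ S, (v i + Real.exp (v i ^ 2)) :=
        Finset.sum_le_sum fun i _ => aux_exp_le _
    _ = ∑ i ∈ S, Real.exp (v i ^ 2) := by rw [Finset.sum_add_distrib, hv, zero_add]
    _ ≤ ∑ i ∈ S, Real.exp (∑ j ∈ S, v j ^ 2) := Finset.sum_le_sum fun i hi =>
        Real.exp_le_exp.2 (Finset.single_le_sum (f := fun j => v j ^ 2)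
          (fun j _ => sq_nonneg _) hi)
    _ = _ := by simp [mul_comm]

lemma aux_exp_lim (A L : ℝ) :
    HasDerivWithinAt (fun γ : ℝ => Real.exp (-γ * A + √(2 * γ) * L)
      - (-γ * A + √(2 * γ) * L)) (L ^ 2) (Set.Ioi 0) 0 := by
  rw [hasDerivWithinAt_iff_isLittleO]
  set v : ℝ → ℝ := fun γ => -γ * A + √(2 * γ) * L with hv
  have hcont : Continuous v := by fun_prop
  have hv0 : Filter.Tendsto v (nhdsWithin 0 (Set.Ioi 0)) (nhds 0) := by
    have : v 0 = 0 := by simp [hv]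
    have h := (hcont.tendsto 0).mono_left (nhdsWithin_le_nhds (s := Set.Ioi 0))
    rwa [this] at h
  have hsq : ∀ γ : ℝ, 0 < γ → v γ ^ 2 =
      γ * (γ * A ^ 2 - 2 * √(2 * γ) * A * L + 2 * L ^ 2) := by
    intro γ hγ
    have := Real.sq_sqrt (show 0 ≤ 2 * γ by linarith)
    simp only [hv]
    linear_combination L ^ 2 * this
  have hlim : Filter.Tendsto (fun γ : ℝ => γ * A ^ 2 - 2 * √(2 * γ) * A * L)
      (nhdsWithin 0 (Set.Ioi 0)) (nhds 0) := by
    have hc : Continuous (fun γ : ℝ => γ * A ^ 2 - 2 * √(2 * γ) * A * L) := by fun_prop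
    have h := (hc.tendsto 0).mono_left (nhdsWithin_le_nhds (s := Set.Ioi 0))
    simpa using h
  have hlo : (fun γ : ℝ => γ * (γ * A ^ 2 - 2 * √(2 * γ) * A * L))
      =o[nhdsWithin 0 (Set.Ioi 0)] fun γ : ℝ => γ := by
    have := (isBigO_refl (fun γ : ℝ => γ) (nhdsWithin 0 (Set.Ioi 0))).mul_isLittleO
      ((isLittleO_one_iff ℝ).2 hlim)
    simpa using this
  have hsqo : (fun γ : ℝ => v γ ^ 2 - 2 * L ^ 2 * γ)
      =o[nhdsWithin 0 (Set.Ioi 0)] fun γ : ℝ => γ := by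
    refine hlo.congr' ?_ Filter.EventuallyEq.rfl
    filter_upwards [self_mem_nhdsWithin] with γ hγ
    rw [hsq γ hγ]; ring
  have hO : (fun γ : ℝ => v γ ^ 2) =O[nhdsWithin 0 (Set.Ioi 0)] fun γ : ℝ => γ := by
    have := hsqo.isBigO.add (isBigO_const_mul_self (2 * L ^ 2) (fun γ : ℝ => γ) _)
    simpa using this
  have he := ((Real.exp_sub_sum_range_succ_isLittleO_pow 2).comp_tendsto hv0).trans_isBigO hO
  have := he.add (hsqo.const_mul_left (1/2))
  refine (this.congr ?_ ?_)
  · intro γ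
    simp [Finset.sum_range_succ, hv]
    ring
  · intro γ; simp

lemma aux_log_lim {ι : Type*} (S : Finset ι) (hS : S.Nonempty) (A L : ι → ℝ)
    (hA : ∑ i ∈ S, A i = 0) (hL : ∑ i ∈ S, L i = 0) :
    Filter.Tendsto (fun γ : ℝ => Real.log ((∑ i ∈ S, Real.exp (-γ * A i + √(2 * γ) * L i))
      / S.card) / γ) (nhdsWithin 0 (Set.Ioi 0)) (nhds ((∑ i ∈ S, L i ^ 2) / S.card)) := by
  have hn : (S.card : ℝ) ≠ 0 := by exact_mod_cast hS.card_pos.ne'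
  have h1 := (HasDerivWithinAt.fun_sum fun i (_ : i ∈ S) => aux_exp_lim (A i) (L i)).div_const
    (S.card : ℝ)
  have h2 : HasDerivWithinAt (fun γ : ℝ => (∑ i ∈ S, Real.exp (-γ * A i + √(2 * γ) * L i))
      / S.card) ((∑ i ∈ S, L i ^ 2) / S.card) (Set.Ioi 0) 0 := by
    refine h1.congr_of_eventuallyEq ?_ ?_ <;>
    simp [Finset.sum_sub_distrib, Finset.sum_add_distrib, ← Finset.mul_sum, hA, hL]
  have h3 := h2.log (by simp [hn])
  rw [hasDerivWithinAt_iff_tendsto_slope' (by simp)] at h3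
  simp only [slope_fun_def_field] at h3
  simpa [hn] using h3

lemma aux_main {X ι : Type*} [MeasurableSpace X] (μ : Measure X) [IsProbabilityMeasure μ]
    (S : Finset ι) (hS : S.Nonempty) (a : ι → ℝ) (l : ι → X → ℝ)
    (hl : ∀ i, MemLp (l i) 2 μ) (hlm : ∀ i, Measurable (l i)) (hl0 : ∀ i, ∫ g, l i g ∂μ = 0) :
    Filter.Tendsto (fun γ : ℝ => ((∫ g, Real.log (∑ i ∈ S, Real.exp
        (-γ * a i + √(2 * γ) * l i g)) ∂μ) - Real.log S.card) / γ)
      (nhdsWithin 0 (Set.Ioi 0))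
      (nhds (-((∑ i ∈ S, a i) / S.card) +
        ∫ g, (∑ i ∈ S, (l i g - (∑ j ∈ S, l j g) / S.card) ^ 2) / S.card ∂μ)) := by
  have hn : (0 : ℝ) < S.card := by exact_mod_cast hS.card_pos
  set ā : ℝ := (∑ i ∈ S, a i) / S.card with hā
  set m : X → ℝ := fun g => (∑ j ∈ S, l j g) / S.card with hm
  have hmm : Measurable m := by fun_prop
  have hmL : MemLp m 2 μ := by
    have := (memLp_finsetSum S fun i _ => hl i).mul_const ((S.card : ℝ)⁻¹)
    simpa [hm, div_eq_mul_inv] using this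
  have hA : ∑ i ∈ S, (a i - ā) = 0 := by
    rw [Finset.sum_sub_distrib]; simp [hā]; field_simp; simp
  have hL : ∀ g, ∑ i ∈ S, (l i g - m g) = 0 := by
    intro g
    rw [Finset.sum_sub_distrib]; simp [hm]; field_simp; simp
  set F : ℝ → X → ℝ := fun γ g => Real.log ((∑ i ∈ S, Real.exp
    (-γ * (a i - ā) + √(2 * γ) * (l i g - m g))) / S.card) with hF
  have hFm : ∀ γ, Measurable (F γ) := by intro γ; fun_prop
  set bd : X → ℝ := fun g => ∑ i ∈ S, (2 * (a i - ā) ^ 2 + 4 * (l i g - m g) ^ 2) with hbd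
  have hbdi : Integrable bd μ := by
    refine integrable_finsetSum _ fun i _ => ?_
    exact (integrable_const _).add (((hl i).sub hmL).integrable_sq.const_mul 4)
  have hb : ∀ γ : ℝ, 0 < γ → γ ≤ 1 → ∀ g, 0 ≤ F γ g ∧ F γ g ≤ γ * bd g := by
    intro γ h0 h1 g
    have := aux_log_bound S hS (fun i => -γ * (a i - ā) + √(2 * γ) * (l i g - m g)) (by
      rw [Finset.sum_add_distrib, ← Finset.mul_sum, ← Finset.mul_sum, hA, hL]; simp)
    refine ⟨this.1, this.2.trans ?_⟩
    simp only [hbd]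
    rw [Finset.mul_sum]
    refine Finset.sum_le_sum fun i _ => ?_
    have hs := Real.sq_sqrt (show 0 ≤ 2 * γ by linarith)
    have e1 : (-γ * (a i - ā) + √(2 * γ) * (l i g - m g)) ^ 2 ≤
      2 * (γ * (a i - ā)) ^ 2 + 2 * (√(2 * γ) * (l i g - m g)) ^ 2 := by
      nlinarith [sq_nonneg (γ * (a i - ā) + √(2 * γ) * (l i g - m g))]
    rw [mul_pow (√(2 * γ)), hs, mul_pow] at e1
    have e2 : γ ^ 2 * (a i - ā) ^ 2 ≤ γ * (a i - ā) ^ 2 :=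
      mul_le_mul_of_nonneg_right (by nlinarith) (sq_nonneg _)
    linarith
  have hlim : Filter.Tendsto (fun γ : ℝ => ∫ g, F γ g / γ ∂μ) (nhdsWithin 0 (Set.Ioi 0))
      (nhds (∫ g, (∑ i ∈ S, (l i g - m g) ^ 2) / S.card ∂μ)) := by
    refine tendsto_integral_filter_of_dominated_convergence bd ?_ ?_ hbdi ?_
    · exact Filter.Eventually.of_forall fun γ => ((hFm γ).div_const γ).aestronglyMeasurable
    · filter_upwards [Ioc_mem_nhdsGT (zero_lt_one (α := ℝ))] with γ hγ
      refine Filter.Eventually.of_forall fun g => ?_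
      have := hb γ hγ.1 hγ.2 g
      rw [Real.norm_of_nonneg (div_nonneg this.1 hγ.1.le), div_le_iff₀ hγ.1]
      linarith [this.2]
    · exact Filter.Eventually.of_forall fun g =>
        aux_log_lim S hS (fun i => a i - ā) (fun i => l i g - m g) hA (hL g)
  refine (hlim.const_add (-ā)).congr' ?_
  filter_upwards [Ioc_mem_nhdsGT (zero_lt_one (α := ℝ))] with γ hγ
  have hFi : Integrable (F γ) μ := by
    refine (hbdi.const_mul γ).mono' (hFm γ).aestronglyMeasurable
      (Filter.Eventually.of_forall fun g => ?_)
    have := hb γ hγ.1 hγ.2 g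
    rw [Real.norm_of_nonneg this.1]; exact this.2
  have hmi : Integrable m μ := hmL.integrable one_le_two
  have hm0 : ∫ g, m g ∂μ = 0 := by
    simp only [hm]
    rw [integral_div, integral_finsetSum _ fun i _ => (hl i).integrable one_le_two]
    simp [hl0]
  have key : ∀ g, Real.log (∑ i ∈ S, Real.exp (-γ * a i + √(2 * γ) * l i g)) =
      (Real.log S.card - γ * ā) + √(2 * γ) * m g + F γ g := by
    intro g
    have hpos : 0 < ∑ i ∈ S, Real.exp (-γ * (a i - ā) + √(2 * γ) * (l i g - m g)) :=
      Finset.sum_pos (fun i _ => Real.exp_pos _) hS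
    have : ∑ i ∈ S, Real.exp (-γ * a i + √(2 * γ) * l i g) =
      Real.exp (-γ * ā + √(2 * γ) * m g) *
        ∑ i ∈ S, Real.exp (-γ * (a i - ā) + √(2 * γ) * (l i g - m g)) := by
      rw [Finset.mul_sum]
      refine Finset.sum_congr rfl fun i _ => ?_
      rw [← Real.exp_add]; congr 1; ring
    rw [this, Real.log_mul (Real.exp_pos _).ne' hpos.ne', Real.log_exp]
    simp only [hF]
    rw [Real.log_div hpos.ne' hn.ne']
    ring
  simp_rw [key]
  have hci : Integrable (fun g => (Real.log S.card - γ * ā) + √(2 * γ) * m g) μ :=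
    (integrable_const _).add (hmi.const_mul _)
  rw [integral_add hci hFi,
    integral_add (integrable_const _) (hmi.const_mul _), integral_const_mul, hm0, integral_div]
  have := hγ.1.ne'
  simp
  field_simp
  ring

lemma aux_gauss {B : ℕ} (β : Fin B → ℝ) :
    MemLp (fun g : Fin B → ℝ => ∑ b, g b * β b) 2
      (Measure.pi fun _ => ProbabilityTheory.gaussianReal 0 1) ∧
    ∫ g : Fin B → ℝ, ∑ b, g b * β b
      ∂(Measure.pi fun _ => ProbabilityTheory.gaussianReal 0 1) = 0 ∧
    ∫ g : Fin B → ℝ, (∑ b, g b * β b) ^ 2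
      ∂(Measure.pi fun _ => ProbabilityTheory.gaussianReal 0 1) = ∑ b, β b ^ 2 := by
  have hb : ∀ b, MemLp (fun y : ℝ => y * β b) 2 (ProbabilityTheory.gaussianReal 0 1) := fun b =>
    (ProbabilityTheory.memLp_id_gaussianReal' 2 (by simp)).mul_const _
  have hb2 : ∀ b, MemLp (fun g : Fin B → ℝ => g b * β b) 2
      (Measure.pi fun _ => ProbabilityTheory.gaussianReal 0 1) := fun b =>
    (hb b).comp_measurePreserving
      (measurePreserving_eval (fun _ : Fin B => ProbabilityTheory.gaussianReal 0 1) b)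
  have h1 : MemLp (fun g : Fin B → ℝ => ∑ b, g b * β b) 2
      (Measure.pi fun _ => ProbabilityTheory.gaussianReal 0 1) :=
    memLp_finsetSum _ fun b _ => hb2 b
  have h2 : ∫ g : Fin B → ℝ, ∑ b, g b * β b
      ∂(Measure.pi fun _ => ProbabilityTheory.gaussianReal 0 1) = 0 := by
    rw [integral_finsetSum _ fun b _ => (hb2 b).integrable one_le_two]
    refine Finset.sum_eq_zero fun b _ => ?_
    rw [integral_comp_eval (μ := fun _ : Fin B => ProbabilityTheory.gaussianReal 0 1)
      (i := b) (f := fun y => y * β b) (hb b).1, integral_mul_const]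
    simp
  refine ⟨h1, h2, ?_⟩
  rw [← ProbabilityTheory.variance_of_integral_eq_zero h1.aemeasurable h2]
  have := ProbabilityTheory.variance_sum_pi hb
  have e : (fun g : Fin B → ℝ => ∑ b, g b * β b) = ∑ b, fun g : Fin B → ℝ => g b * β b := by
    ext g; simp
  rw [e, this]
  refine Finset.sum_congr rfl fun b _ => ?_
  rw [ProbabilityTheory.variance_mul_const, ProbabilityTheory.variance_fun_id_gaussianReal]
  simp

lemma aux_pairs {ι : Type*} (S : Finset ι) (hS : S.Nonempty) (l : ι → ℝ) :
    (∑ i ∈ S, (l i - (∑ j ∈ S, l j) / S.card) ^ 2) / S.card =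
      (1 / (2 * (S.card : ℝ) ^ 2)) * ∑ i ∈ S, ∑ j ∈ S, (l i - l j) ^ 2 := by
  have hn : (S.card : ℝ) ≠ 0 := by exact_mod_cast hS.card_pos.ne'
  simp only [sub_sq, Finset.sum_add_distrib, Finset.sum_sub_distrib, ← Finset.mul_sum,
    ← Finset.sum_mul, Finset.sum_const, nsmul_eq_mul]
  field_simp
  ring

theorem stmt_19 (B : ℕ) (hB : 1 ≤ B) (Ω : Finset (Fin B → ℝ)) (hΩ : Ω.Nonempty)
    (M : ℕ) (hM : M = Ω.card) (α : Fin B → ℝ)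
    (μ : Measure (Fin B → ℝ))
    (hμ : μ = Measure.pi fun _ => ProbabilityTheory.gaussianReal 0 1)
    (V : Fin B → ℝ)
    (hV : ∀ b, V b = (1 / (2 * (M : ℝ) ^ 2)) * ∑ x ∈ Ω, ∑ x' ∈ Ω, (x b - x' b) ^ 2)
    (c : ℝ) (hc : c = (∑ b, (α b) ^ 2 * V b) / Real.log 2)
    (J : ℝ → ℝ)
    (hJ : ∀ γ : ℝ, J γ = Real.logb 2 M - (1 / (M : ℝ)) * ∑ x ∈ Ω,
      ∫ g, Real.logb 2 (∑ x' ∈ Ω, Real.exp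
        (-γ * ∑ b, (α b) ^ 2 * (x b - x' b) ^ 2 +
          Real.sqrt (2 * γ) * ∑ b, g b * α b * (x b - x' b))) ∂μ) :
    (fun γ => J γ - γ * c) =o[nhdsWithin 0 (Set.Ioi 0)] fun γ : ℝ => γ := by
  have hn : (M : ℝ) ≠ 0 := by rw [hM]; exact_mod_cast hΩ.card_pos.ne'
  have hlog : Real.log 2 ≠ 0 := (Real.log_pos (by norm_num)).ne'
  have : IsProbabilityMeasure μ := by rw [hμ]; infer_instance
  set K : ℝ := ∑ b, (α b) ^ 2 * V b with hK
  have hK2 : ∑ x ∈ Ω, ∑ x' ∈ Ω, ∑ b, (α b) ^ 2 * (x b - x' b) ^ 2 = 2 * (M : ℝ) ^ 2 * K := by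
    have e : ∀ b, (α b) ^ 2 * ∑ x ∈ Ω, ∑ x' ∈ Ω, (x b - x' b) ^ 2 =
        2 * (M : ℝ) ^ 2 * ((α b) ^ 2 * V b) := by
      intro b; rw [hV]; field_simp
    rw [hK, Finset.mul_sum]
    simp_rw [← e, Finset.mul_sum]
    rw [Finset.sum_comm (s := Finset.univ)]
    refine Finset.sum_congr rfl fun x _ => ?_
    rw [Finset.sum_comm]
  have hg : ∀ x x' : Fin B → ℝ, MemLp (fun g : Fin B → ℝ => ∑ b, g b * α b * (x b - x' b)) 2 μ ∧
      ∫ g : Fin B → ℝ, ∑ b, g b * α b * (x b - x' b) ∂μ = 0 ∧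
      ∫ g : Fin B → ℝ, (∑ b, g b * α b * (x b - x' b)) ^ 2 ∂μ =
        ∑ b, (α b) ^ 2 * (x b - x' b) ^ 2 := by
    intro x x'
    have := aux_gauss (fun b => α b * (x b - x' b))
    rw [← hμ] at this
    simpa [mul_assoc, mul_pow] using this
  have hvar : ∀ x : Fin B → ℝ, ∫ g : Fin B → ℝ, (∑ i ∈ Ω, ((∑ b, g b * α b * (x b - i b)) -
      (∑ j ∈ Ω, ∑ b, g b * α b * (x b - j b)) / Ω.card) ^ 2) / Ω.card ∂μ = K := by
    intro x
    have e : ∀ (g i j : Fin B → ℝ), ((∑ b, g b * α b * (x b - i b)) -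
        ∑ b, g b * α b * (x b - j b)) = ∑ b, g b * α b * (j b - i b) := by
      intro g i j
      rw [← Finset.sum_sub_distrib]
      exact Finset.sum_congr rfl fun b _ => by ring
    have e2 : ∀ g : Fin B → ℝ, (∑ i ∈ Ω, ((∑ b, g b * α b * (x b - i b)) -
      (∑ j ∈ Ω, ∑ b, g b * α b * (x b - j b)) / Ω.card) ^ 2) / Ω.card =
      (1 / (2 * (M : ℝ) ^ 2)) * ∑ i ∈ Ω, ∑ j ∈ Ω, (∑ b, g b * α b * (j b - i b)) ^ 2 := by
      intro g
      rw [aux_pairs Ω hΩ (fun i => ∑ b, g b * α b * (x b - i b)), ← hM]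
      simp_rw [e]
    simp_rw [e2]
    rw [integral_const_mul, integral_finsetSum _ fun i _ =>
      integrable_finsetSum _ fun j _ => (hg j i).1.integrable_sq]
    have e3 : ∀ i ∈ Ω, ∫ g : Fin B → ℝ, ∑ j ∈ Ω, (∑ b, g b * α b * (j b - i b)) ^ 2 ∂μ =
        ∑ j ∈ Ω, ∑ b, (α b) ^ 2 * (j b - i b) ^ 2 := by
      intro i _
      rw [integral_finsetSum _ fun j _ => (hg j i).1.integrable_sq]
      exact Finset.sum_congr rfl fun j _ => (hg j i).2.2
    rw [Finset.sum_congr rfl e3, Finset.sum_comm, hK2]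
    field_simp
  have hx : ∀ x ∈ Ω, _ := fun x (_ : x ∈ Ω) => aux_main μ Ω hΩ
    (fun x' => ∑ b, (α b) ^ 2 * (x b - x' b) ^ 2)
    (fun x' g => ∑ b, g b * α b * (x b - x' b)) (fun x' => (hg x x').1)
    (fun x' => by fun_prop) (fun x' => (hg x x').2.1)
  have hsum := (tendsto_finsetSum Ω hx).const_mul (-(1 / ((M : ℝ) * Real.log 2)))
  have hval : -(1 / ((M : ℝ) * Real.log 2)) * (∑ x ∈ Ω,
      (-((∑ i ∈ Ω, ∑ b, (α b) ^ 2 * (x b - i b) ^ 2) / (Ω.card : ℝ)) +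
      ∫ g : Fin B → ℝ, (∑ i ∈ Ω, ((∑ b, g b * α b * (x b - i b)) -
      (∑ j ∈ Ω, ∑ b, g b * α b * (x b - j b)) / Ω.card) ^ 2) / Ω.card ∂μ)) = c := by
    simp_rw [hvar]
    rw [Finset.sum_add_distrib, Finset.sum_neg_distrib, ← Finset.sum_div, hK2, hc, ← hM]
    simp only [Finset.sum_const, nsmul_eq_mul, ← hM]
    field_simp
    ring
  rw [hval] at hsum
  have hJ2 : Filter.Tendsto (fun γ => J γ / γ) (nhdsWithin 0 (Set.Ioi 0)) (nhds c) := by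
    refine hsum.congr' ?_
    filter_upwards [self_mem_nhdsWithin] with γ hγ
    have hγ' : γ ≠ 0 := ne_of_gt hγ
    rw [hJ]
    simp only [Real.logb, integral_div]
    rw [← Finset.sum_div, ← Finset.sum_div, Finset.sum_sub_distrib]
    simp only [Finset.sum_const, nsmul_eq_mul, ← hM]
    field_simp
    ring
  rw [isLittleO_iff_tendsto' (by
    filter_upwards [self_mem_nhdsWithin] with γ hγ h
    exact absurd h (ne_of_gt hγ))]
  have h0 := hJ2.sub_const c
  rw [sub_self] at h0
  refine h0.congr' ?_
  filter_upwards [self_mem_nhdsWithin] with γ hγ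
  have hγ' : γ ≠ 0 := ne_of_gt hγ
  field_simp
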